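/- Let Ω' ⊆ ℝ^{n'} and Ω ⊆ ℝ^n be open and let T be a basic functional in L(G_c(Ω),ℂ̃), defined by a net (T_ε) of distributions. If u ∈ G_c^∞(Ω'×Ω) then T(u(x,·)) := [(T_ε(u_ε(x,·)))_ε] belongs to G_c^∞(Ω'). -/

import Mathlib

noncomputable section

open Set MeasureTheory Topology

/-- Euclidean space `ℝ^n`. -/
abbrev Rn (n : ℕ) := EuclideanSpace ℝ (Fin n)

namespace Colombeau

/-- A net of smooth functions on the open set `Ω ⊆ E` is *moderate*:
for every compact `K ⊆ Ω` and derivative order `i` there is `N` with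
`sup_{x∈K} ‖∂^i u_ε(x)‖ = O(ε^{-N})` as `ε → 0`. -/
def IsModerate {E : Type} [NormedAddCommGroup E] [NormedSpace ℝ E]
    (Ω : Set E) (u : ℝ → E → ℂ) : Prop :=
  (∀ ε ∈ Ioc (0:ℝ) 1, ContDiffOn ℝ (⊤ : ℕ∞) (u ε) Ω) ∧
  ∀ K : Set E, IsCompact K → K ⊆ Ω → ∀ i : ℕ,
    ∃ N : ℕ, ∃ c > 0, ∃ η ∈ Ioc (0:ℝ) 1, ∀ ε ∈ Ioc (0:ℝ) η, ∀ x ∈ K,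
      ‖iteratedFDeriv ℝ i (u ε) x‖ ≤ c * ε ^ (-(N:ℝ))

/-- A net of smooth functions on `Ω` is *negligible*:
for every compact `K ⊆ Ω`, derivative order `i` and every `q`,
`sup_{x∈K} ‖∂^i u_ε(x)‖ = O(ε^q)` as `ε → 0`. -/
def IsNegligible {E : Type} [NormedAddCommGroup E] [NormedSpace ℝ E]
    (Ω : Set E) (u : ℝ → E → ℂ) : Prop :=
  (∀ ε ∈ Ioc (0:ℝ) 1, ContDiffOn ℝ (⊤ : ℕ∞) (u ε) Ω) ∧
  ∀ K : Set E, IsCompact K → K ⊆ Ω → ∀ i : ℕ, ∀ q : ℕ,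
    ∃ c > 0, ∃ η ∈ Ioc (0:ℝ) 1, ∀ ε ∈ Ioc (0:ℝ) η, ∀ x ∈ K,
      ‖iteratedFDeriv ℝ i (u ε) x‖ ≤ c * ε ^ (q:ℝ)

/-- `G^∞`-moderateness: on each compact set the exponent `N` is uniform in the
derivative order. -/
def IsGinfModerate {E : Type} [NormedAddCommGroup E] [NormedSpace ℝ E]
    (Ω : Set E) (u : ℝ → E → ℂ) : Prop :=
  (∀ ε ∈ Ioc (0:ℝ) 1, ContDiffOn ℝ (⊤ : ℕ∞) (u ε) Ω) ∧
  ∀ K : Set E, IsCompact K → K ⊆ Ω → ∃ N : ℕ, ∀ i : ℕ,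
    ∃ c > 0, ∃ η ∈ Ioc (0:ℝ) 1, ∀ ε ∈ Ioc (0:ℝ) η, ∀ x ∈ K,
      ‖iteratedFDeriv ℝ i (u ε) x‖ ≤ c * ε ^ (-(N:ℝ))

/-- The net `u` has all its supports contained in one fixed compact subset of `Ω`. -/
def HasCmpSupp {E : Type} [NormedAddCommGroup E] [NormedSpace ℝ E]
    (Ω : Set E) (u : ℝ → E → ℂ) : Prop :=
  ∃ K : Set E, IsCompact K ∧ K ⊆ Ω ∧ ∀ ε ∈ Ioc (0:ℝ) 1, tsupport (u ε) ⊆ K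

/-- Moderate nets of complex numbers (representatives of elements of `ℂ̃`). -/
def CIsModerate (z : ℝ → ℂ) : Prop :=
  ∃ N : ℕ, ∃ c > 0, ∃ η ∈ Ioc (0:ℝ) 1, ∀ ε ∈ Ioc (0:ℝ) η, ‖z ε‖ ≤ c * ε ^ (-(N:ℝ))

/-- Negligible nets of complex numbers. -/
def CIsNegligible (z : ℝ → ℂ) : Prop :=
  ∀ q : ℕ, ∃ c > 0, ∃ η ∈ Ioc (0:ℝ) 1, ∀ ε ∈ Ioc (0:ℝ) η, ‖z ε‖ ≤ c * ε ^ (q:ℝ)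

/-- `S` is a distribution on `Ω`: for each compact `K ⊆ Ω` it is continuous with respect
to some seminorm `sup_{x∈K, |α|≤j} |∂^α f(x)|` on smooth functions supported in `K`. -/
def IsDistributionOn {n : ℕ} (Ω : Set (Rn n)) (S : (Rn n → ℂ) →ₗ[ℂ] ℂ) : Prop :=
  ∀ K : Set (Rn n), IsCompact K → K ⊆ Ω →
    ∃ j : ℕ, ∃ C : ℝ, 0 ≤ C ∧ ∀ f : Rn n → ℂ, ContDiffOn ℝ (⊤ : ℕ∞) f Ω → tsupport f ⊆ K →
      ∀ B : ℝ, (∀ x ∈ K, ∀ i ≤ j, ‖iteratedFDeriv ℝ i f x‖ ≤ B) → ‖S f‖ ≤ C * B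

/-- `S` is a compactly supported distribution on `Ω`. -/
def IsCptSuppDistributionOn {n : ℕ} (Ω : Set (Rn n)) (S : (Rn n → ℂ) →ₗ[ℂ] ℂ) : Prop :=
  ∃ K : Set (Rn n), IsCompact K ∧ K ⊆ Ω ∧
    ∃ j : ℕ, ∃ C : ℝ, 0 ≤ C ∧ ∀ f : Rn n → ℂ, ContDiffOn ℝ (⊤ : ℕ∞) f Ω →
      ∀ B : ℝ, (∀ x ∈ K, ∀ i ≤ j, ‖iteratedFDeriv ℝ i f x‖ ≤ B) → ‖S f‖ ≤ C * B

/-- A net of distributions on `Ω` defining a *basic* functional on `G_c(Ω)`: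
for every compact `K ⊆ Ω` there are `j`, `N`, `η ∈ (0,1]` with
`|T_ε(f)| ≤ ε^{-N} sup_{x∈K,|α|≤j} |∂^α f(x)|` for all smooth `f` supported in `K`
and all `ε ≤ η`. -/
def IsBasicNetC {n : ℕ} (Ω : Set (Rn n)) (T : ℝ → (Rn n → ℂ) →ₗ[ℂ] ℂ) : Prop :=
  (∀ ε ∈ Ioc (0:ℝ) 1, IsDistributionOn Ω (T ε)) ∧
  ∀ K : Set (Rn n), IsCompact K → K ⊆ Ω →
    ∃ j N : ℕ, ∃ η ∈ Ioc (0:ℝ) 1, ∀ ε ∈ Ioc (0:ℝ) η,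
      ∀ f : Rn n → ℂ, ContDiffOn ℝ (⊤ : ℕ∞) f Ω → tsupport f ⊆ K →
        ∀ C : ℝ, 0 ≤ C → (∀ x ∈ K, ∀ i ≤ j, ‖iteratedFDeriv ℝ i f x‖ ≤ C) →
          ‖T ε f‖ ≤ ε ^ (-(N:ℝ)) * C

/-- A net of compactly supported distributions on `Ω` defining a *basic* functional on
`G(Ω)`: there are a compact `K ⊆ Ω` and `j`, `N`, `η ∈ (0,1]` with
`|T_ε(f)| ≤ ε^{-N} sup_{x∈K,|α|≤j} |∂^α f(x)|` for all `f ∈ C^∞(Ω)` and all `ε ≤ η`. -/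
def IsBasicNetE {n : ℕ} (Ω : Set (Rn n)) (T : ℝ → (Rn n → ℂ) →ₗ[ℂ] ℂ) : Prop :=
  (∀ ε ∈ Ioc (0:ℝ) 1, IsCptSuppDistributionOn Ω (T ε)) ∧
  ∃ K : Set (Rn n), IsCompact K ∧ K ⊆ Ω ∧
    ∃ j N : ℕ, ∃ η ∈ Ioc (0:ℝ) 1, ∀ ε ∈ Ioc (0:ℝ) η,
      ∀ f : Rn n → ℂ, ContDiffOn ℝ (⊤ : ℕ∞) f Ω →
        ∀ C : ℝ, 0 ≤ C → (∀ x ∈ K, ∀ i ≤ j, ‖iteratedFDeriv ℝ i f x‖ ≤ C) →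
          ‖T ε f‖ ≤ ε ^ (-(N:ℝ)) * C

end Colombeau

open Colombeau

namespace Colombeau

open Filter
open scoped ContDiff

section Taylor

variable {E G : Type} [NormedAddCommGroup E] [NormedSpace ℝ E]
  [NormedAddCommGroup G] [NormedSpace ℝ G]

/-- The first-order Taylor remainder of `w` at `z` with increment `h`. -/
def taylorRem (w : E → G) (h z : E) : G := w (z + h) - w z - fderiv ℝ w z h

theorem contDiff_taylorRem {w : E → G} (hw : ContDiff ℝ ∞ w) (h : E) :
    ContDiff ℝ ∞ (taylorRem w h) := by
  have h1 : ContDiff ℝ ∞ (fderiv ℝ w) := hw.fderiv_right (by simp)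
  have h2 : ContDiff ℝ ∞ fun z => w (z + h) := hw.comp (contDiff_id.add contDiff_const)
  exact (h2.sub hw).sub (h1.clm_apply contDiff_const)

theorem fderiv_taylorRem {w : E → G} (hw : ContDiff ℝ ∞ w) (h : E) :
    fderiv ℝ (taylorRem w h) = taylorRem (fderiv ℝ w) h := by
  have h1 : ContDiff ℝ ∞ (fderiv ℝ w) := hw.fderiv_right (by simp)
  have hd : Differentiable ℝ w := hw.differentiable (by simp)
  have hd1 : Differentiable ℝ (fderiv ℝ w) := h1.differentiable (by simp)
  ext z e
  have hshift : HasFDerivAt (fun z => w (z + h)) (fderiv ℝ w (z + h)) z :=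
    (hasFDerivAt_comp_add_right h).2 (hd (z + h)).hasFDerivAt
  have hrem : HasFDerivAt (taylorRem w h) _ z :=
    (hshift.sub (hd z).hasFDerivAt).sub
      ((hd1 z).hasFDerivAt.clm_apply (hasFDerivAt_const h z))
  have hsymm : IsSymmSndFDerivAt ℝ w z :=
    hw.contDiffAt.isSymmSndFDerivAt (by simpa using WithTop.coe_le_coe.2 (le_top : (2 : ℕ∞) ≤ ⊤))
  rw [hrem.fderiv]
  simp [taylorRem, hsymm.eq e h]

theorem exists_norm_taylorRem_le {w : E → G} (hw : ContDiff ℝ ∞ w) (hc : HasCompactSupport w) :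
    ∃ C : ℝ, 0 ≤ C ∧ ∀ h z, ‖taylorRem w h z‖ ≤ C * ‖h‖ ^ 2 := by
  have h1 : ContDiff ℝ ∞ (fderiv ℝ w) := hw.fderiv_right (by simp)
  have hd : Differentiable ℝ w := hw.differentiable (by simp)
  obtain ⟨L, hL⟩ := h1.lipschitzWith_of_hasCompactSupport (hc.fderiv ℝ) (by simp)
  refine ⟨L, L.2, fun h z => ?_⟩
  have key := (convex_segment z (z + h)).norm_image_sub_le_of_norm_fderiv_le' (𝕜 := ℝ)
    (f := w) (φ := fderiv ℝ w z) (C := L * ‖h‖) (fun x _ => hd x) (fun x hx => ?_)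
    (left_mem_segment ℝ z (z + h)) (right_mem_segment ℝ z (z + h))
  · simpa [taylorRem, sq, mul_assoc] using key
  · refine (hL.norm_sub_le x z).trans ?_
    gcongr
    simpa using norm_sub_le_of_mem_segment hx

theorem exists_norm_iteratedFDeriv_taylorRem_le (k : ℕ) {G : Type} [NormedAddCommGroup G]
    [NormedSpace ℝ G] {w : E → G} (hw : ContDiff ℝ ∞ w) (hc : HasCompactSupport w) :
    ∃ C : ℝ, 0 ≤ C ∧ ∀ h z, ‖iteratedFDeriv ℝ k (taylorRem w h) z‖ ≤ C * ‖h‖ ^ 2 := by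
  induction k generalizing G with
  | zero => simpa using exists_norm_taylorRem_le hw hc
  | succ k ih =>
    obtain ⟨C, hC, hb⟩ := ih (hw.fderiv_right (m := ∞) (by simp)) (hc.fderiv ℝ)
    refine ⟨C, hC, fun h z => ?_⟩
    rw [← norm_iteratedFDeriv_fderiv, fderiv_taylorRem hw]
    exact hb h z

theorem contDiff_iteratedFDeriv_apply {w : E → G} (hw : ContDiff ℝ ∞ w) (i : ℕ) (m : Fin i → E) :
    ContDiff ℝ ∞ fun z => iteratedFDeriv ℝ i w z m :=
  (ContinuousMultilinearMap.apply ℝ (fun _ : Fin i => E) G m).contDiff.comp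
    (hw.iteratedFDeriv_right (m := ∞) (by norm_cast))

theorem tsupport_iteratedFDeriv_apply_subset (w : E → G) (i : ℕ) (m : Fin i → E) :
    tsupport (fun z => iteratedFDeriv ℝ i w z m) ⊆ tsupport w :=
  (tsupport_comp_subset (g := fun L : ContinuousMultilinearMap ℝ (fun _ : Fin i => E) G =>
    L m) rfl _).trans (tsupport_iteratedFDeriv_subset i)

theorem norm_iteratedFDeriv_iteratedFDeriv_apply_le {w : E → G} (hw : ContDiff ℝ ∞ w) (i k : ℕ)
    (m : Fin i → E) (z : E) :
    ‖iteratedFDeriv ℝ k (fun z => iteratedFDeriv ℝ i w z m) z‖ ≤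
      (∏ l, ‖m l‖) * ‖iteratedFDeriv ℝ (i + k) w z‖ := by
  induction i generalizing k with
  | zero =>
    rw [zero_add]
    simp
  | succ i ih =>
    have hg := contDiff_iteratedFDeriv_apply hw i (Fin.tail m)
    have heq : (fun z => iteratedFDeriv ℝ (i + 1) w z m) =
        fun z => fderiv ℝ (fun z => iteratedFDeriv ℝ i w z (Fin.tail m)) z (m 0) :=
      funext fun z => ((hw.differentiable_iteratedFDeriv (m := i)
        (by exact_mod_cast WithTop.coe_lt_top i)) z).iteratedFDeriv_succ_apply_left'
    rw [heq]
    refine (norm_iteratedFDeriv_clm_apply_const (N := ∞)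
      (hg.fderiv_right (m := ∞) (by simp)).contDiffAt (by exact_mod_cast le_top)).trans ?_
    rw [norm_iteratedFDeriv_fderiv, Fin.prod_univ_succ, mul_assoc, add_right_comm, add_assoc]
    exact mul_le_mul_of_nonneg_left (ih (k + 1) (Fin.tail m)) (norm_nonneg _)

end Taylor

theorem tsupport_slice_subset {E F G : Type} [TopologicalSpace E] [TopologicalSpace F] [Zero G]
    {f : E × F → G} {K₁ : Set E} {K₂ : Set F} (hK₂ : IsClosed K₂)
    (hf : tsupport f ⊆ K₁ ×ˢ K₂) (x : E) : tsupport (fun y => f (x, y)) ⊆ K₂ :=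
  closure_minimal (fun _ hy => (hf (subset_tsupport f hy)).2) hK₂

section Slice

variable {E F G : Type} [NormedAddCommGroup E] [NormedSpace ℝ E]
  [NormedAddCommGroup F] [NormedSpace ℝ F] [NormedAddCommGroup G] [NormedSpace ℝ G]

theorem norm_iteratedFDeriv_slice_le {f : E × F → G} (hf : ContDiff ℝ ∞ f) (k : ℕ)
    (x : E) (y : F) :
    ‖iteratedFDeriv ℝ k (fun y => f (x, y)) y‖ ≤ ‖iteratedFDeriv ℝ k f (x, y)‖ := by
  have heq : (fun y => f (x, y)) =
      (fun z => f ((x, 0) + z)) ∘ ContinuousLinearMap.inr ℝ E F := by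
    ext y; simp
  have hs : ContDiff ℝ ∞ fun z => f ((x, 0) + z) := hf.comp (contDiff_const.add contDiff_id)
  rw [heq, ContinuousLinearMap.iteratedFDeriv_comp_right _ hs _ (by exact_mod_cast le_top),
    iteratedFDeriv_comp_add_left]
  refine (ContinuousMultilinearMap.norm_compContinuousLinearMap_le _ _).trans ?_
  simp only [ContinuousLinearMap.inr_apply, Prod.mk_add_mk, add_zero, zero_add]
  refine mul_le_of_le_one_right (norm_nonneg _) (Finset.prod_le_one (fun _ _ => norm_nonneg _) ?_)
  exact fun _ _ => ContinuousLinearMap.norm_inr_le_one ℝ E F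

end Slice

/-- A linear functional is bounded, with constant `C`, by the derivatives up to order `j` on `K`
for smooth functions supported in `K`. -/
def BoundedOn {F : Type} [NormedAddCommGroup F] [NormedSpace ℝ F]
    (S : (F → ℂ) →ₗ[ℂ] ℂ) (K : Set F) (j : ℕ) (C : ℝ) : Prop :=
  ∀ f : F → ℂ, ContDiff ℝ ∞ f → tsupport f ⊆ K → ∀ B : ℝ, 0 ≤ B →
    (∀ y ∈ K, ∀ k ≤ j, ‖iteratedFDeriv ℝ k f y‖ ≤ B) → ‖S f‖ ≤ C * B

section Parameter

variable {E F : Type} [NormedAddCommGroup E] [NormedSpace ℝ E] [FiniteDimensional ℝ E]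
  [NormedAddCommGroup F] [NormedSpace ℝ F]
  {S : (F → ℂ) →ₗ[ℂ] ℂ} {K₁ : Set E} {K₂ : Set F} {j : ℕ} {C : ℝ} {w : E × F → ℂ}

theorem hasFDerivAt_functional_slice (hS : BoundedOn S K₂ j C) (hK₁ : IsCompact K₁)
    (hK₂ : IsCompact K₂) (hw : ContDiff ℝ ∞ w) (hsupp : tsupport w ⊆ K₁ ×ˢ K₂) (x : E) :
    ∃ L : E →L[ℝ] ℂ, (∀ v, L v = S fun y => fderiv ℝ w (x, y) (v, 0)) ∧
      HasFDerivAt (fun x => S fun y => w (x, y)) L x := by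
  have hc : HasCompactSupport w :=
    (hK₁.prod hK₂).of_isClosed_subset (isClosed_tsupport w) hsupp
  let L₀ : E →ₗ[ℝ] ℂ :=
    { toFun := fun v => S fun y => fderiv ℝ w (x, y) (v, 0)
      map_add' := fun v v' => by
        rw [← map_add]
        congr 1
        ext y
        rw [Pi.add_apply, ← map_add, Prod.mk_add_mk, add_zero]
      map_smul' := fun c v => by
        rw [RingHom.id_apply, ← LinearMap.map_smul_of_tower]
        congr 1
        ext y
        rw [Pi.smul_apply, ← map_smul, Prod.smul_mk, smul_zero] }
  refine ⟨LinearMap.toContinuousLinearMap L₀, fun v => rfl, ?_⟩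
  choose A hA0 hA using fun k => exists_norm_iteratedFDeriv_taylorRem_le k hw hc
  set M := ∑ k ∈ Finset.range (j + 1), A k
  have hM : 0 ≤ M := Finset.sum_nonneg fun k _ => hA0 k
  have hbound : ∀ v, ‖S (fun y => w (x + v, y)) - S (fun y => w (x, y)) - L₀ v‖
      ≤ C * M * ‖v‖ ^ 2 := by
    intro v
    have hrem : S (fun y => w (x + v, y)) - S (fun y => w (x, y)) - L₀ v =
        S fun y => taylorRem w (v, 0) (x, y) := by
      change _ - _ - S _ = _
      rw [← map_sub, ← map_sub]
      congr 1
      ext y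
      simp [taylorRem]
    have hsmooth := contDiff_taylorRem hw (v, (0 : F))
    rw [hrem, mul_assoc]
    refine hS _ (hsmooth.comp (contDiff_prodMk_right x)) ?_ _ (by positivity) fun y _ k hk => ?_
    · refine closure_minimal (fun y hy => ?_) hK₂.isClosed
      by_contra hyK
      have hzero : ∀ x', (x', y) ∉ tsupport w := fun x' hx' => hyK (hsupp hx').2
      apply hy
      have hder : fderiv ℝ w (x, y) = 0 := by
        by_contra hne
        exact hzero x (support_fderiv_subset ℝ hne)
      simp [taylorRem, hder, image_eq_zero_of_notMem_tsupport (hzero _)]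
    · refine (norm_iteratedFDeriv_slice_le hsmooth k x y).trans ((hA k _ _).trans ?_)
      have : ‖(v, (0 : F))‖ = ‖v‖ := by simp
      rw [this]
      gcongr
      exact Finset.single_le_sum (fun k _ => hA0 k) (Finset.mem_range.2 (Nat.lt_succ_of_le hk))
  rw [hasFDerivAt_iff_isLittleO_nhds_zero]
  refine Asymptotics.IsBigO.trans_isLittleO (g := fun v : E => ‖v‖ ^ 2)
    (Asymptotics.IsBigO.of_bound (C * M) (Eventually.of_forall fun v => ?_)) ?_
  · simpa using hbound v
  · exact Asymptotics.isLittleO_norm_pow_id one_lt_two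

theorem fderiv_functional_slice_apply (hS : BoundedOn S K₂ j C)
    (hK₁ : IsCompact K₁) (hK₂ : IsCompact K₂) (hw : ContDiff ℝ ∞ w)
    (hsupp : tsupport w ⊆ K₁ ×ˢ K₂) (x v : E) :
    fderiv ℝ (fun x => S fun y => w (x, y)) x v = S fun y => fderiv ℝ w (x, y) (v, 0) := by
  obtain ⟨L, hL, hd⟩ := hasFDerivAt_functional_slice hS hK₁ hK₂ hw hsupp x
  rw [hd.fderiv, hL]

theorem contDiff_functional_slice (hS : BoundedOn S K₂ j C)
    (hK₁ : IsCompact K₁) (hK₂ : IsCompact K₂) (hw : ContDiff ℝ ∞ w)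
    (hsupp : tsupport w ⊆ K₁ ×ˢ K₂) : ContDiff ℝ ∞ fun x => S fun y => w (x, y) := by
  have hdiff : ∀ {w : E × F → ℂ}, ContDiff ℝ ∞ w → tsupport w ⊆ K₁ ×ˢ K₂ →
      Differentiable ℝ fun x => S fun y => w (x, y) := fun hw hsupp x =>
    let ⟨_, _, hd⟩ := hasFDerivAt_functional_slice hS hK₁ hK₂ hw hsupp x
    hd.differentiableAt
  rw [contDiff_infty]
  intro m
  induction m generalizing w with
  | zero => exact contDiff_zero.2 (hdiff hw hsupp).continuous
  | succ m ih =>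
    push_cast
    refine contDiff_succ_iff_fderiv_apply.2 ⟨hdiff hw hsupp, by simp, fun v => ?_⟩
    simp_rw [fderiv_functional_slice_apply hS hK₁ hK₂ hw hsupp]
    exact ih ((hw.fderiv_right (m := ∞) (by simp)).clm_apply contDiff_const)
      ((tsupport_fderiv_apply_subset ℝ (v, (0 : F))).trans hsupp)

theorem iteratedFDeriv_functional_slice_apply (hS : BoundedOn S K₂ j C)
    (hK₁ : IsCompact K₁) (hK₂ : IsCompact K₂) (hw : ContDiff ℝ ∞ w)
    (hsupp : tsupport w ⊆ K₁ ×ˢ K₂) (i : ℕ) (x : E) (v : Fin i → E) :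
    iteratedFDeriv ℝ i (fun x => S fun y => w (x, y)) x v =
      S fun y => iteratedFDeriv ℝ i w (x, y) fun l => (v l, 0) := by
  induction i generalizing x with
  | zero => simp
  | succ i ih =>
    have hF := contDiff_functional_slice hS hK₁ hK₂ hw hsupp
    rw [((hF.differentiable_iteratedFDeriv (m := i)
      (by exact_mod_cast WithTop.coe_lt_top i)) x).iteratedFDeriv_succ_apply_left']
    simp_rw [ih]
    rw [fderiv_functional_slice_apply hS hK₁ hK₂ (contDiff_iteratedFDeriv_apply hw i _)
      ((tsupport_iteratedFDeriv_apply_subset w i _).trans hsupp)]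
    congr 1
    ext y
    rw [((hw.differentiable_iteratedFDeriv (m := i)
      (by exact_mod_cast WithTop.coe_lt_top i)) (x, y)).iteratedFDeriv_succ_apply_left']
    rfl

theorem norm_iteratedFDeriv_functional_slice_le (hS : BoundedOn S K₂ j C) (hC : 0 ≤ C)
    (hK₁ : IsCompact K₁) (hK₂ : IsCompact K₂) (hw : ContDiff ℝ ∞ w)
    (hsupp : tsupport w ⊆ K₁ ×ˢ K₂) (i : ℕ) (x : E) {B : ℝ} (hB : 0 ≤ B)
    (hbd : ∀ y ∈ K₂, ∀ k ≤ j, ‖iteratedFDeriv ℝ (i + k) w (x, y)‖ ≤ B) :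
    ‖iteratedFDeriv ℝ i (fun x => S fun y => w (x, y)) x‖ ≤ C * B := by
  refine ContinuousMultilinearMap.opNorm_le_bound (by positivity) fun v => ?_
  rw [iteratedFDeriv_functional_slice_apply hS hK₁ hK₂ hw hsupp, mul_assoc]
  set m : Fin i → E × F := fun l => (v l, 0)
  have hsm := contDiff_iteratedFDeriv_apply hw i m
  have hsp := (tsupport_iteratedFDeriv_apply_subset w i m).trans hsupp
  refine hS _ (hsm.comp (contDiff_prodMk_right x))
    (tsupport_slice_subset hK₂.isClosed hsp x) _ (by positivity) fun y hy k hk => ?_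
  refine (norm_iteratedFDeriv_slice_le hsm k x y).trans ?_
  refine (norm_iteratedFDeriv_iteratedFDeriv_apply_le hw i k m (x, y)).trans ?_
  rw [mul_comm]
  have hm : ∏ l, ‖m l‖ = ∏ l, ‖v l‖ := by simp [m]
  rw [hm]
  gcongr
  exact hbd y hy k hk

end Parameter

theorem contDiff_of_tsupport_subset {E : Type} [NormedAddCommGroup E] [NormedSpace ℝ E]
    {U : Set E} {f : E → ℂ} (hU : IsOpen U) (hf : ContDiffOn ℝ ∞ f U) (hsupp : tsupport f ⊆ U) :
    ContDiff ℝ ∞ f := by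
  refine contDiff_iff_contDiffAt.2 fun x => ?_
  by_cases hx : x ∈ U
  · exact hf.contDiffAt (hU.mem_nhds hx)
  · exact contDiffAt_const.congr_of_eventuallyEq
      (notMem_tsupport_iff_eventuallyEq.1 fun h => hx (hsupp h))

theorem IsGinfModerate.exists_uniform_bound {E : Type} [NormedAddCommGroup E] [NormedSpace ℝ E]
    {Ω : Set E} {u : ℝ → E → ℂ} (hu : IsGinfModerate Ω u) {K : Set E} (hK : IsCompact K)
    (hKΩ : K ⊆ Ω) :
    ∃ N : ℕ, ∀ i j : ℕ, ∃ c > 0, ∃ η ∈ Ioc (0:ℝ) 1, ∀ ε ∈ Ioc (0:ℝ) η, ∀ x ∈ K, ∀ k ≤ j,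
      ‖iteratedFDeriv ℝ (i + k) (u ε) x‖ ≤ c * ε ^ (-(N:ℝ)) := by
  obtain ⟨N, hN⟩ := hu.2 K hK hKΩ
  refine ⟨N, fun i j => ?_⟩
  induction j with
  | zero =>
    obtain ⟨c, hc, η, hη, h⟩ := hN i
    refine ⟨c, hc, η, hη, fun ε hε x hx k hk => ?_⟩
    obtain rfl := Nat.le_zero.1 hk
    exact h ε hε x hx
  | succ j ih =>
    obtain ⟨c, hc, η, hη, h⟩ := ih
    obtain ⟨c', hc', η', hη', h'⟩ := hN (i + (j + 1))
    refine ⟨max c c', lt_max_of_lt_left hc, min η η',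
      ⟨lt_min hη.1 hη'.1, (min_le_left _ _).trans hη.2⟩, fun ε hε x hx k hk => ?_⟩
    have hpow : 0 ≤ ε ^ (-(N:ℝ)) := Real.rpow_nonneg hε.1.le _
    rcases Nat.le_succ_iff.1 hk with hk | rfl
    · exact (h ε ⟨hε.1, hε.2.trans (min_le_left _ _)⟩ x hx k hk).trans
        (mul_le_mul_of_nonneg_right (le_max_left _ _) hpow)
    · exact (h' ε ⟨hε.1, hε.2.trans (min_le_right _ _)⟩ x hx).trans
        (mul_le_mul_of_nonneg_right (le_max_right _ _) hpow)

end Colombeau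

/-- Let `Ω' ⊆ ℝ^{n'}` and `Ω ⊆ ℝ^n` be open and let `T` be a basic
functional in `L(G_c(Ω),ℂ̃)`, defined by a net `(T_ε)` of distributions.  If
`u ∈ G_c^∞(Ω'×Ω)` then `T(u(x,·)) := [(T_ε(u_ε(x,·)))_ε]` belongs to `G_c^∞(Ω')`. -/
theorem statement1
    {n' n : ℕ} (Ω' : Set (Rn n')) (Ω : Set (Rn n))
    (hΩ' : IsOpen Ω') (hΩ : IsOpen Ω)
    (T : ℝ → (Rn n → ℂ) →ₗ[ℂ] ℂ) (hT : IsBasicNetC Ω T)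
    (u : ℝ → (Rn n' × Rn n) → ℂ)
    (hu : IsGinfModerate (Ω' ×ˢ Ω) u)
    (K₁ : Set (Rn n')) (K₂ : Set (Rn n))
    (hK₁ : IsCompact K₁) (hK₁Ω : K₁ ⊆ Ω') (hK₂ : IsCompact K₂) (hK₂Ω : K₂ ⊆ Ω)
    (hsupp : ∀ ε ∈ Ioc (0:ℝ) 1, tsupport (u ε) ⊆ K₁ ×ˢ K₂) :
    IsGinfModerate Ω' (fun ε x => T ε (fun y => u ε (x, y))) ∧
      ∀ ε ∈ Ioc (0:ℝ) 1, tsupport (fun x => T ε (fun y => u ε (x, y))) ⊆ K₁ := by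
  have hsmooth : ∀ ε ∈ Ioc (0:ℝ) 1, ContDiff ℝ (⊤ : ℕ∞) (u ε) := fun ε hε =>
    contDiff_of_tsupport_subset (hΩ'.prod hΩ) (hu.1 ε hε)
      ((hsupp ε hε).trans (prod_mono hK₁Ω hK₂Ω))
  refine ⟨⟨fun ε hε => ?_, fun K hK hKΩ => ?_⟩, fun ε hε => ?_⟩
  · obtain ⟨j, C, -, hS⟩ := hT.1 ε hε K₂ hK₂ hK₂Ω
    have hb : BoundedOn (T ε) K₂ j C := fun f hf hs B _ h => hS f hf.contDiffOn hs B h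
    exact (contDiff_functional_slice hb hK₁ hK₂ (hsmooth ε hε) (hsupp ε hε)).contDiffOn
  · obtain ⟨j, M, η₁, hη₁, hM⟩ := hT.2 K₂ hK₂ hK₂Ω
    obtain ⟨N, hN⟩ := hu.exists_uniform_bound (hK.prod hK₂) (prod_mono hKΩ hK₂Ω)
    refine ⟨M + N, fun i => ?_⟩
    obtain ⟨c, hc, η₂, hη₂, hbd⟩ := hN i j
    refine ⟨c, hc, min η₁ η₂, ⟨lt_min hη₁.1 hη₂.1, (min_le_left _ _).trans hη₁.2⟩,
      fun ε hε x hx => ?_⟩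
    have hε₁ : ε ∈ Ioc (0:ℝ) η₁ := ⟨hε.1, hε.2.trans (min_le_left _ _)⟩
    have hε₂ : ε ∈ Ioc (0:ℝ) η₂ := ⟨hε.1, hε.2.trans (min_le_right _ _)⟩
    have hε' : ε ∈ Ioc (0:ℝ) 1 := ⟨hε.1, hε₁.2.trans hη₁.2⟩
    have hb : BoundedOn (T ε) K₂ j (ε ^ (-(M:ℝ))) :=
      fun f hf hs B hB h => hM ε hε₁ f hf.contDiffOn hs B hB h
    have hpow : ∀ a : ℝ, 0 ≤ ε ^ a := Real.rpow_nonneg hε.1.le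
    refine (norm_iteratedFDeriv_functional_slice_le hb (hpow _) hK₁ hK₂ (hsmooth ε hε')
      (hsupp ε hε') i x (mul_nonneg hc.le (hpow (-(N:ℝ))))
      fun y hy k hk => hbd ε hε₂ (x, y) ⟨hx, hy⟩ k hk).trans_eq ?_
    rw [mul_left_comm, ← Real.rpow_add hε.1]
    push_cast
    rw [neg_add]
  · refine closure_minimal (fun x hx => ?_) hK₁.isClosed
    by_contra hxK
    refine hx ?_
    have hzero : (fun y => u ε (x, y)) = 0 := funext fun y =>
      image_eq_zero_of_notMem_tsupport fun h => hxK (hsupp ε hε h).1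
    change T ε _ = 0
    rw [hzero, map_zero]
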